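/- arXiv:1405.6749 — 6 statements merged into one kernel-verified Lean document; each statement's English description precedes it below -/
import Mathlib

section
/- For every p ∈ (0,1) and every real λ, one has p·exp(λ(1−p)) + (1−p)·exp(−λp) ≤ exp(Q(p)²·λ²), where Q(p)² = (1−2p)/(4·ln((1−p)/p)) for p ≠ 1/2 and Q(1/2)² = 1/8. (Kearns–Saul inequality, inequality (2.3) of the paper.) -/
/-- `Q(p)²`: square of the subgaussian norm of the centered indicator with parameter `p`. -/
noncomputable def Qsq (p : ℝ) : ℝ :=
  if p = 1/2 then 1/8 else (1 - 2*p) / (4 * Real.log ((1 - p) / p))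

lemma convexOn_sinh_Ici : ConvexOn ℝ (Set.Ici 0) Real.sinh := by
  refine MonotoneOn.convexOn_of_deriv (convex_Ici 0) Real.continuous_sinh.continuousOn
    Real.differentiable_sinh.differentiableOn ?_
  rw [interior_Ici, Real.deriv_sinh]
  intro x hx y hy hxy
  rw [Real.cosh_le_cosh, abs_of_pos hx, abs_of_pos hy]
  exact hxy

lemma mul_sinh_le_mul_sinh {s t : ℝ} (hs : 0 ≤ s) (hst : s ≤ t) :
    t * Real.sinh s ≤ s * Real.sinh t := by
  rcases (hs.trans hst).eq_or_lt with rfl | ht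
  · simp [le_antisymm hst hs]
  have h := convexOn_sinh_Ici.2 (Set.mem_Ici.2 ht.le) (Set.mem_Ici.2 le_rfl)
    (div_nonneg hs ht.le) (sub_nonneg.2 ((div_le_one ht).2 hst)) (by ring)
  simp only [smul_eq_mul, mul_zero, add_zero, Real.sinh_zero, div_mul_cancel₀ s ht.ne'] at h
  calc t * Real.sinh s ≤ t * (s / t * Real.sinh t) := by gcongr
    _ = s * Real.sinh t := by field_simp

/-- The function `x ↦ tanh x / x` is antitone on the positive reals, with denominators cleared. -/
lemma mul_sinh_mul_cosh_le {x y : ℝ} (hx : 0 ≤ x) (hxy : x ≤ y) :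
    x * Real.sinh y * Real.cosh x ≤ y * Real.sinh x * Real.cosh y := by
  have h := mul_sinh_le_mul_sinh (sub_nonneg.2 hxy) (show y - x ≤ y + x by linarith)
  rw [Real.sinh_sub, Real.sinh_add] at h
  linarith

lemma hasDerivAt_cosh_mul_exp (c x : ℝ) :
    HasDerivAt (fun x => Real.cosh x * Real.exp (-(c * x ^ 2)))
      ((Real.sinh x - 2 * c * x * Real.cosh x) * Real.exp (-(c * x ^ 2))) x := by
  have h : HasDerivAt (fun x : ℝ => -(c * x ^ 2)) (-(c * (2 * x))) x := by
    simpa using ((hasDerivAt_pow 2 x).const_mul c).fun_neg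
  exact ((Real.hasDerivAt_cosh x).fun_mul h.exp).congr_deriv (by ring)

lemma cosh_mul_exp_le_of_pos {a x : ℝ} (ha : 0 < a) (hx : 0 ≤ x) :
    Real.cosh x * Real.exp (-(Real.tanh a / (2 * a) * x ^ 2)) ≤
      Real.cosh a * Real.exp (-(Real.tanh a / (2 * a) * a ^ 2)) := by
  set c := Real.tanh a / (2 * a) with hc
  have hd := hasDerivAt_cosh_mul_exp c
  have hcont : Continuous fun x => Real.cosh x * Real.exp (-(c * x ^ 2)) :=
    continuous_iff_continuousAt.2 fun y => (hd y).continuousAt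
  have hca := Real.cosh_pos a
  have key (y : ℝ) : Real.sinh y - 2 * c * y * Real.cosh y =
      (a * Real.sinh y * Real.cosh a - y * Real.sinh a * Real.cosh y) / (a * Real.cosh a) := by
    rw [hc, Real.tanh_eq_sinh_div_cosh]
    field_simp
  rcases le_total x a with hxa | hax
  · refine monotoneOn_of_deriv_nonneg (convex_Icc 0 a) hcont.continuousOn
      (fun y _ => (hd y).differentiableAt.differentiableWithinAt) (fun y hy => ?_)
      ⟨hx, hxa⟩ ⟨ha.le, le_rfl⟩ hxa
    rw [interior_Icc] at hy
    rw [(hd y).deriv, key]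
    have := mul_sinh_mul_cosh_le hy.1.le hy.2.le
    exact mul_nonneg (div_nonneg (by linarith) (by positivity)) (Real.exp_pos _).le
  · refine antitoneOn_of_deriv_nonpos (convex_Ici a) hcont.continuousOn
      (fun y _ => (hd y).differentiableAt.differentiableWithinAt) (fun y hy => ?_)
      (Set.mem_Ici.2 le_rfl) hax hax
    rw [interior_Ici] at hy
    rw [(hd y).deriv, key]
    have := mul_sinh_mul_cosh_le ha.le (le_of_lt hy)
    exact mul_nonpos_of_nonpos_of_nonneg
      (div_nonpos_of_nonpos_of_nonneg (by linarith) (by positivity)) (Real.exp_pos _).le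

/-- Gaussian-type bound for `cosh`, tangent at `±a`: the function `log (cosh √t)` lies below its
tangent at `t = a ^ 2`. -/
lemma cosh_le_cosh_mul_exp {a : ℝ} (ha : a ≠ 0) (x : ℝ) :
    Real.cosh x ≤ Real.cosh a * Real.exp (Real.tanh a / (2 * a) * (x ^ 2 - a ^ 2)) := by
  have heven : Real.tanh |a| / (2 * |a|) = Real.tanh a / (2 * a) := by
    rcases abs_choice a with h | h <;> rw [h]
    rw [Real.tanh_neg, mul_neg, neg_div_neg_eq]
  have h := cosh_mul_exp_le_of_pos (abs_pos.2 ha) (abs_nonneg x)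
  rw [heven, sq_abs, sq_abs, Real.cosh_abs, Real.cosh_abs] at h
  set c := Real.tanh a / (2 * a)
  calc Real.cosh x = Real.cosh x * Real.exp (-(c * x ^ 2)) * Real.exp (c * x ^ 2) := by
        rw [mul_assoc, ← Real.exp_add]; simp
    _ ≤ Real.cosh a * Real.exp (-(c * a ^ 2)) * Real.exp (c * x ^ 2) := by gcongr
    _ = Real.cosh a * Real.exp (c * (x ^ 2 - a ^ 2)) := by
        rw [mul_assoc, ← Real.exp_add]; ring_nf

/-- Kearns–Saul inequality (inequality (2.3) of the paper). -/
theorem kearns_saul (p : ℝ) (hp : p ∈ Set.Ioo (0:ℝ) 1) (l : ℝ) :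
    p * Real.exp (l * (1 - p)) + (1 - p) * Real.exp (-(l * p)) ≤
      Real.exp (Qsq p * l^2) := by
  obtain ⟨hp0, hp1⟩ := hp
  unfold Qsq
  split_ifs with hhalf
  · subst hhalf
    have h := Real.cosh_le_exp_half_sq (l / 2)
    rw [Real.cosh_eq] at h
    convert h using 1
    · ring_nf
    · ring_nf
  have hq : 0 < 1 - p := sub_pos.2 hp1
  set a := Real.log ((1 - p) / p) / 2 with ha_def
  have hlog : Real.log ((1 - p) / p) = 2 * a := by rw [ha_def]; ring
  have hexp : Real.exp a * Real.exp a * p = 1 - p := by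
    rw [← Real.exp_add, ← two_mul, ← hlog, Real.exp_log (by positivity)]
    field_simp
  have hinv : Real.exp a * Real.exp (-a) = 1 := by rw [← Real.exp_add]; simp
  have ha : a ≠ 0 := by
    intro h
    rw [h, Real.exp_zero] at hexp
    exact hhalf (by linarith)
  have hca := Real.cosh_pos a
  have hp_eq : p * (2 * Real.cosh a) = Real.exp (-a) := by
    rw [Real.cosh_eq]
    linear_combination Real.exp (-a) * hexp - Real.exp a * p * hinv
  have hq_eq : (1 - p) * (2 * Real.cosh a) = Real.exp a := by
    have := Real.cosh_eq a
    linear_combination 2 * this - hp_eq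
  have htanh : Real.tanh a = 1 - 2 * p := by
    rw [Real.tanh_eq_sinh_div_cosh, div_eq_iff hca.ne', Real.sinh_eq]
    linear_combination (hp_eq - hq_eq) / 2
  have h := cosh_le_cosh_mul_exp ha (l / 2 - a)
  rw [htanh] at h
  rw [hlog]
  have hmgf : p * Real.exp (l * (1 - p)) + (1 - p) * Real.exp (-(l * p)) =
      Real.exp (l * (1 - 2 * p) / 2) * Real.cosh (l / 2 - a) / Real.cosh a := by
    have h1 : Real.exp (l * (1 - p)) = Real.exp (l * (1 - 2 * p) / 2) * Real.exp (l / 2) := by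
      rw [← Real.exp_add]; ring_nf
    have h2 : Real.exp (-(l * p)) = Real.exp (l * (1 - 2 * p) / 2) * Real.exp (-(l / 2)) := by
      rw [← Real.exp_add]; ring_nf
    have h3 : Real.exp (l / 2 - a) = Real.exp (l / 2) * Real.exp (-a) := by
      rw [← Real.exp_add]; ring_nf
    have h4 : Real.exp (-(l / 2 - a)) = Real.exp (-(l / 2)) * Real.exp a := by
      rw [← Real.exp_add]; ring_nf
    rw [eq_div_iff hca.ne', Real.cosh_eq (l / 2 - a), h1, h2, h3, h4, ← hp_eq, ← hq_eq]
    ring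
  rw [hmgf, div_le_iff₀ hca]
  calc Real.exp (l * (1 - 2 * p) / 2) * Real.cosh (l / 2 - a)
      ≤ Real.exp (l * (1 - 2 * p) / 2) * (Real.cosh a *
          Real.exp ((1 - 2 * p) / (2 * a) * ((l / 2 - a) ^ 2 - a ^ 2))) := by gcongr
    _ = Real.exp (l * (1 - 2 * p) / 2 + (1 - 2 * p) / (2 * a) * ((l / 2 - a) ^ 2 - a ^ 2)) *
          Real.cosh a := by rw [Real.exp_add]; ring
    _ = Real.exp ((1 - 2 * p) / (4 * (2 * a)) * l ^ 2) * Real.cosh a := by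
        congr 2
        field_simp
        ring
end

section
/- Let p ∈ (0,1), p ≠ 1/2, and set λ₀ = 2·ln((1−p)/p). Then p·exp(λ₀(1−p)) + (1−p)·exp(−λ₀·p) = exp(Q(p)²·λ₀²), where Q(p)² = (1−2p)/(4·ln((1−p)/p)). Equivalently, √(ln(p·e^{λ₀(1−p)} + (1−p)·e^{−λ₀p}))/|λ₀| = Q(p). (The equality (2.5) giving the lower bound in Theorem 2.1.) -/
/-- Equality (2.5): at `λ₀ = 2 ln((1-p)/p)` the mgf of the centered indicator attains the
subgaussian bound with constant `Q(p)² = (1-2p)/(4 ln((1-p)/p))`. -/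
theorem mgf_eq_at_lambda_zero (p : ℝ) (hp : p ∈ Set.Ioo (0:ℝ) 1) (hp2 : p ≠ 1/2) :
    p * Real.exp ((2 * Real.log ((1 - p) / p)) * (1 - p)) +
      (1 - p) * Real.exp (-((2 * Real.log ((1 - p) / p)) * p)) =
    Real.exp ((1 - 2*p) / (4 * Real.log ((1 - p) / p)) *
      (2 * Real.log ((1 - p) / p))^2) := by
  obtain ⟨h0, h1⟩ := hp
  have hr : 0 < (1 - p) / p := div_pos (by linarith) h0
  have hr1 : (1 - p) / p ≠ 1 := fun h => hp2 (by rw [div_eq_one_iff_eq h0.ne'] at h; linarith)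
  have hE : Real.exp (Real.log ((1 - p) / p)) = (1 - p) / p := Real.exp_log hr
  have hL : Real.log ((1 - p) / p) ≠ 0 := Real.log_ne_zero_of_pos_of_ne_one hr hr1
  generalize Real.log ((1 - p) / p) = L at hE hL ⊢
  have e1 : 2 * L * (1 - p) = L + L + -(2 * L * p) := by ring
  have e2 : (1 - 2 * p) / (4 * L) * (2 * L) ^ 2 = L + -(2 * L * p) := by
    field_simp
    ring
  rw [e1, e2, Real.exp_add, Real.exp_add, Real.exp_add, hE]
  field_simp
  ring
end

section
/- Let p ∈ (0,1) and let η_p be a random variable with P(η_p = 1−p) = p and P(η_p = −p) = 1−p. Then the subgaussian norm of η_p equals Q(p); that is, sup over λ ≠ 0 of √(ln E exp(λη_p))/|λ| equals Q(p), where Q(p)² = (1−2p)/(4·ln((1−p)/p)) for p ≠ 1/2 and Q(1/2)² = 1/8. (Theorem 2.1.) -/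
open MeasureTheory

/-- `Q(p)`: the subgaussian norm of the centered indicator with parameter `p`. -/
noncomputable def Q (p : ℝ) : ℝ := Real.sqrt (Qsq p)

open Real in
/-- `tanh x / x` is antitone on the positive half-line, stated without division. -/
lemma mul_tanh_le_mul_tanh {x y : ℝ} (hx : 0 ≤ x) (hxy : x ≤ y) :
    x * tanh y ≤ y * tanh x := by
  have hconv : ConvexOn ℝ (Set.Ici 0) sinh := by
    refine MonotoneOn.convexOn_of_deriv (convex_Ici 0) continuous_sinh.continuousOn
      differentiable_sinh.differentiableOn ?_
    rw [Real.deriv_sinh, interior_Ici]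
    exact cosh_strictMonoOn.monotoneOn.mono Set.Ioi_subset_Ici_self
  have key : (x + y) * sinh (y - x) ≤ (y - x) * sinh (x + y) := by
    rcases hxy.eq_or_lt with rfl | hlt
    · simp
    · have h := hconv.secant_mono (a := 0) (x := y - x) (y := x + y) (by simp)
        (by simp [hxy]) (Set.mem_Ici.2 (by linarith)) (by linarith) (by linarith) (by linarith)
      simp only [sinh_zero, sub_zero] at h
      rw [div_le_div_iff₀ (by linarith) (by linarith)] at h
      linarith
  rw [tanh_eq_sinh_div_cosh, tanh_eq_sinh_div_cosh, mul_div_assoc', mul_div_assoc',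
    div_le_div_iff₀ (cosh_pos y) (cosh_pos x)]
  rw [sinh_sub, sinh_add] at key
  nlinarith [key]

open Real in
lemma hasDerivAt_log_cosh (x : ℝ) : HasDerivAt (fun x => log (cosh x)) (tanh x) x := by
  rw [tanh_eq_sinh_div_cosh]
  exact (hasDerivAt_cosh x).log (cosh_pos x).ne'

open Real in
/-- Tangent-line bound for `log ∘ cosh`, viewed as a concave function of the square of its
argument. -/
lemma log_cosh_sub_log_cosh_le {a : ℝ} (ha : a ≠ 0) (s : ℝ) :
    log (cosh s) - log (cosh a) ≤ tanh a / (2 * a) * (s ^ 2 - a ^ 2) := by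
  wlog hs : 0 ≤ s generalizing s
  · simpa using this (-s) (by linarith)
  wlog hpos : 0 < a generalizing a
  · have hneg : 0 < -a := by
      rcases lt_or_gt_of_ne ha with h | h
      · linarith
      · exact absurd h hpos
    simpa [neg_div_neg_eq] using this hneg.ne' hneg
  set f : ℝ → ℝ := fun x => tanh a / (2 * a) * x ^ 2 - log (cosh x) with hf
  have hderiv (x : ℝ) : HasDerivAt f ((x * tanh a - a * tanh x) / a) x := by
    refine (((hasDerivAt_pow 2 x).const_mul (tanh a / (2 * a))).sub
      (hasDerivAt_log_cosh x)).congr_deriv ?_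
    field_simp
    norm_num
    ring
  have hcont : Continuous f :=
    continuous_iff_continuousAt.2 fun x => (hderiv x).continuousAt
  have hdiff : Differentiable ℝ f := fun x => (hderiv x).differentiableAt
  suffices f a ≤ f s by
    simp only [hf] at this
    linarith
  rcases le_total s a with hsa | has
  · refine antitoneOn_of_deriv_nonpos (convex_Icc 0 a) hcont.continuousOn
      hdiff.differentiableOn (fun x hx => ?_) ⟨hs, hsa⟩ ⟨hpos.le, le_rfl⟩ hsa
    rw [interior_Icc] at hx
    rw [(hderiv x).deriv]
    exact div_nonpos_of_nonpos_of_nonneg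
      (by linarith [mul_tanh_le_mul_tanh hx.1.le hx.2.le]) hpos.le
  · refine monotoneOn_of_deriv_nonneg (convex_Ici a) hcont.continuousOn
      hdiff.differentiableOn (fun x hx => ?_) (Set.mem_Ici.2 le_rfl) has has
    rw [interior_Ici] at hx
    rw [(hderiv x).deriv]
    exact div_nonneg (by linarith [mul_tanh_le_mul_tanh hpos.le (le_of_lt hx)]) hpos.le

open Real in
lemma one_add_sq_half_le_cosh (x : ℝ) : 1 + x ^ 2 / 2 ≤ cosh x := by
  have h1 : cosh x = 1 + 2 * sinh (x / 2) ^ 2 := by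
    have h := cosh_two_mul (x / 2)
    rw [mul_div_cancel₀ x two_ne_zero, cosh_sq] at h
    linarith
  have h2 : (x / 2) ^ 2 ≤ sinh (x / 2) ^ 2 := by
    rw [sq_le_sq, abs_sinh]
    exact self_le_sinh_iff.2 (abs_nonneg _)
  rw [h1]
  linarith

/-- Moment generating function of a variable taking the value `1 - p` with probability `p` and
`-p` with probability `1 - p`. -/
lemma integral_exp_mul_centered_indicator
    {Ω : Type*} [MeasurableSpace Ω] (μ : Measure Ω) [IsProbabilityMeasure μ]
    {p : ℝ} (hp : p ∈ Set.Ioo (0 : ℝ) 1) {η : Ω → ℝ} (hmeas : Measurable η)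
    (h1 : μ {ω | η ω = 1 - p} = ENNReal.ofReal p)
    (h2 : μ {ω | η ω = -p} = ENNReal.ofReal (1 - p)) (l : ℝ) :
    ∫ ω, Real.exp (l * η ω) ∂μ
      = p * Real.exp (l * (1 - p)) + (1 - p) * Real.exp (l * -p) := by
  have hp0 : 0 ≤ p := hp.1.le
  have hp1 : 0 ≤ 1 - p := by linarith [hp.2]
  set A := {ω | η ω = 1 - p} with hA
  set B := {ω | η ω = -p} with hB
  have hAm : MeasurableSet A := hmeas (measurableSet_singleton _)
  have hBm : MeasurableSet B := hmeas (measurableSet_singleton _)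
  have hAB : Disjoint A B := by
    refine Set.disjoint_left.2 fun ω ha hb => ?_
    simp only [hA, hB, Set.mem_ofPred_eq] at ha hb
    linarith
  have hae : ∀ᵐ ω ∂μ, ω ∈ A ∪ B := by
    change A ∪ B ∈ ae μ
    rw [mem_ae_iff_prob_eq_one (hAm.union hBm), measure_union hAB hBm, h1, h2, ← ENNReal.ofReal_add hp0 hp1]
    simp
  have heq : (fun ω => Real.exp (l * η ω)) =ᵐ[μ] fun ω =>
      A.indicator (fun _ => Real.exp (l * (1 - p))) ω
        + B.indicator (fun _ => Real.exp (l * -p)) ω := by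
    filter_upwards [hae] with ω hω
    rcases hω with h | h
    · rw [Set.indicator_of_mem h, Set.indicator_of_notMem (Set.disjoint_left.1 hAB h), add_zero,
        show η ω = 1 - p from h]
    · rw [Set.indicator_of_mem h, Set.indicator_of_notMem (Set.disjoint_right.1 hAB h), zero_add,
        show η ω = -p from h]
  rw [integral_congr_ae heq, integral_add ((integrable_const _).indicator hAm)
    ((integrable_const _).indicator hBm), integral_indicator_const _ hAm,
    integral_indicator_const _ hBm, measureReal_def, measureReal_def, h1, h2,
    ENNReal.toReal_ofReal hp0, ENNReal.toReal_ofReal hp1, smul_eq_mul, smul_eq_mul]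

open Real in
/-- Cumulant generating function of the centered indicator, in terms of half its log-odds. -/
lemma log_centered_indicator_mgf {p a : ℝ} (hp : p * (2 * cosh a) = exp (-a)) (l : ℝ) :
    log (p * exp (l * (1 - p)) + (1 - p) * exp (l * -p))
      = l / 2 * tanh a + log (cosh (l / 2 - a)) - log (cosh a) := by
  have hc := cosh_pos a
  have hp' : p = exp (-a) / (2 * cosh a) := by rw [eq_div_iff (by positivity), hp]
  have hq : 1 - p = exp a / (2 * cosh a) := by
    rw [eq_div_iff (by positivity), sub_mul, hp, cosh_eq]
    ring
  have ht : tanh a = 1 - 2 * p := by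
    rw [tanh_eq_sinh_div_cosh, div_eq_iff hc.ne']
    have : sinh a = cosh a - exp (-a) := by rw [sinh_eq, cosh_eq]; ring
    linarith
  have key : p * exp (l * (1 - p)) + (1 - p) * exp (l * -p)
      = exp (l / 2 * tanh a) * cosh (l / 2 - a) / cosh a := by
    have e1 : exp (l * (1 - p)) = exp (l / 2 * tanh a) * exp (l / 2) := by
      rw [← exp_add, ht]; ring_nf
    have e2 : exp (l * -p) = exp (l / 2 * tanh a) * exp (-(l / 2)) := by
      rw [← exp_add, ht]; ring_nf
    rw [e1, e2, hq]
    nth_rw 1 [hp']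
    rw [cosh_eq (l / 2 - a), neg_sub, sub_eq_add_neg (l / 2), exp_add,
      sub_eq_add_neg a, exp_add]
    field_simp
  rw [key, log_div (mul_ne_zero (exp_ne_zero _) (cosh_pos _).ne') hc.ne',
    log_mul (exp_ne_zero _) (cosh_pos _).ne', log_exp]

open Real in
lemma Qsq_eq_of_log_odds {p a : ℝ} (hp : p * (2 * cosh a) = exp (-a)) :
    Qsq p = if a = 0 then 1 / 8 else tanh a / (8 * a) := by
  have hc := cosh_pos a
  have hs : sinh a = (1 - 2 * p) * cosh a := by
    have : sinh a = cosh a - exp (-a) := by rw [sinh_eq, cosh_eq]; ring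
    linarith
  have hiff : p = 1 / 2 ↔ a = 0 := by
    rw [← sinh_eq_zero, hs, mul_eq_zero, or_iff_left hc.ne']
    constructor <;> intro h <;> linarith
  have ht : tanh a = 1 - 2 * p := by rw [tanh_eq_sinh_div_cosh, hs, mul_div_cancel_right₀ _ hc.ne']
  have hodds : (1 - p) / p = exp (2 * a) := by
    have hp0 : p ≠ 0 := by
      rintro rfl
      exact exp_ne_zero (-a) (by simpa using hp.symm)
    have hq : (1 - p) * (2 * cosh a) = exp a := by
      rw [sub_mul, hp, cosh_eq]; ring
    rw [div_eq_iff hp0]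
    refine mul_right_cancel₀ (b := 2 * cosh a) (by positivity) ?_
    rw [hq, mul_assoc, hp, ← exp_add]
    ring_nf
  simp only [Qsq, hiff, hodds, log_exp, ← ht]
  congr 2
  ring

open Real in
lemma log_centered_indicator_mgf_le {p a : ℝ} (hp : p * (2 * cosh a) = exp (-a)) (l : ℝ) :
    l / 2 * tanh a + log (cosh (l / 2 - a)) - log (cosh a) ≤ Qsq p * l ^ 2 := by
  rw [Qsq_eq_of_log_odds hp]
  split_ifs with ha
  · subst ha
    have h := log_le_log (cosh_pos (l / 2)) (cosh_le_exp_half_sq (l / 2))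
    rw [log_exp] at h
    simp only [tanh_zero, cosh_zero, log_one, sub_zero, mul_zero, zero_add]
    linarith
  · have h := log_cosh_sub_log_cosh_le ha (l / 2 - a)
    have e : tanh a / (2 * a) * ((l / 2 - a) ^ 2 - a ^ 2)
        = tanh a / (8 * a) * l ^ 2 - l / 2 * tanh a := by
      field_simp
      ring
    linarith

open Real in
lemma exists_log_odds {p : ℝ} (hp : p ∈ Set.Ioo (0 : ℝ) 1) :
    ∃ a, p * (2 * cosh a) = exp (-a) := by
  have hp0 := hp.1
  have hq : 0 < 1 - p := by linarith [hp.2]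
  refine ⟨log ((1 - p) / p) / 2, ?_⟩
  set a := log ((1 - p) / p) / 2 with ha
  have h : exp a * exp a = (1 - p) / p := by
    rw [← exp_add, ha, add_halves, exp_log (by positivity)]
  rw [eq_div_iff hp0.ne'] at h
  rw [cosh_eq, exp_neg]
  have := exp_pos a
  field_simp
  linarith

/-- Theorem 2.1: the subgaussian norm of the centered indicator `η_p`, i.e.
`sup_{λ ≠ 0} √(ln E exp(λ η_p)) / |λ|`, equals `Q(p)`. -/
theorem subgaussian_norm_centered_indicator
    {Ω : Type*} [MeasurableSpace Ω] (μ : Measure Ω) [IsProbabilityMeasure μ]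
    (p : ℝ) (hp : p ∈ Set.Ioo (0:ℝ) 1) (η : Ω → ℝ) (hmeas : Measurable η)
    (h1 : μ {ω | η ω = 1 - p} = ENNReal.ofReal p)
    (h2 : μ {ω | η ω = -p} = ENNReal.ofReal (1 - p)) :
    (⨆ l : {l : ℝ // l ≠ 0},
      Real.sqrt (Real.log (∫ ω, Real.exp (l.1 * η ω) ∂μ)) / |l.1|) = Q p := by
  obtain ⟨a, ha⟩ := exists_log_odds hp
  have hval (l : ℝ) : Real.log (∫ ω, Real.exp (l * η ω) ∂μ)
      = l / 2 * Real.tanh a + Real.log (Real.cosh (l / 2 - a)) - Real.log (Real.cosh a) := by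
    rw [integral_exp_mul_centered_indicator μ hp hmeas h1 h2, log_centered_indicator_mgf ha]
  simp only [hval]
  have hle (l : {l : ℝ // l ≠ 0}) :
      Real.sqrt (l.1 / 2 * Real.tanh a + Real.log (Real.cosh (l.1 / 2 - a))
        - Real.log (Real.cosh a)) / |l.1| ≤ Q p := by
    rw [div_le_iff₀ (abs_pos.2 l.2), Q, ← Real.sqrt_sq_eq_abs, ← Real.sqrt_mul' _ (sq_nonneg _)]
    exact Real.sqrt_le_sqrt (log_centered_indicator_mgf_le ha l.1)
  have hbdd : BddAbove (Set.range fun l : {l : ℝ // l ≠ 0} =>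
      Real.sqrt (l.1 / 2 * Real.tanh a + Real.log (Real.cosh (l.1 / 2 - a))
        - Real.log (Real.cosh a)) / |l.1|) := ⟨Q p, by rintro _ ⟨l, rfl⟩; exact hle l⟩
  have : Nonempty {l : ℝ // l ≠ 0} := ⟨⟨1, one_ne_zero⟩⟩
  refine le_antisymm (ciSup_le hle) ?_
  rw [Q, Qsq_eq_of_log_odds ha]
  split_ifs with h0
  · subst h0
    have hlim : Filter.Tendsto (fun l : ℝ => Real.sqrt (1 / 8 / (1 + l ^ 2 / 8)))
        (nhdsWithin 0 {0}ᶜ) (nhds (Real.sqrt (1 / 8))) := by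
      have hc : Continuous fun l : ℝ => Real.sqrt (1 / 8 / (1 + l ^ 2 / 8)) :=
        (continuous_const.div (by fun_prop) fun l => by positivity).sqrt
      simpa using (hc.tendsto 0).mono_left nhdsWithin_le_nhds
    refine le_of_tendsto hlim ?_
    filter_upwards [self_mem_nhdsWithin] with l hl
    refine le_trans ?_ (le_ciSup hbdd ⟨l, hl⟩)
    have hl : l ≠ 0 := hl
    simp only [Real.tanh_zero, Real.cosh_zero, Real.log_one, sub_zero, mul_zero, zero_add]
    rw [le_div_iff₀ (abs_pos.2 hl), ← Real.sqrt_sq_eq_abs, ← Real.sqrt_mul' _ (sq_nonneg _)]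
    refine Real.sqrt_le_sqrt ?_
    have hpos : 0 < 1 + (l / 2) ^ 2 / 2 := by positivity
    calc 1 / 8 / (1 + l ^ 2 / 8) * l ^ 2 = 1 - (1 + (l / 2) ^ 2 / 2)⁻¹ := by
          field_simp
          ring
      _ ≤ Real.log (1 + (l / 2) ^ 2 / 2) := Real.one_sub_inv_le_log_of_pos hpos
      _ ≤ Real.log (Real.cosh (l / 2)) := Real.log_le_log hpos (one_add_sq_half_le_cosh _)
  · have h4 : 4 * a ≠ 0 := mul_ne_zero four_ne_zero h0
    refine le_trans (le_of_eq ?_) (le_ciSup hbdd ⟨4 * a, h4⟩)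
    rw [eq_div_iff (abs_pos.2 h4).ne', ← Real.sqrt_sq_eq_abs, ← Real.sqrt_mul' _ (sq_nonneg _)]
    congr 1
    rw [show 4 * a / 2 - a = a by ring]
    field_simp
    ring
end

section
/- Let p ∈ (0,1) and let τ be a nonnegative real with τ < Q(p), where Q(p)² = (1−2p)/(4·ln((1−p)/p)) for p ≠ 1/2 and Q(1/2)² = 1/8. Then there exists λ ∈ ℝ with p·exp(λ(1−p)) + (1−p)·exp(−λp) > exp(τ²·λ²). In other words, Q(p) is the minimal subgaussian parameter of the centered indicator with parameter p. (Minimality part of Theorem 2.1.) -/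
/-- The hyperbolic cosine dominates its second Taylor polynomial. -/
theorem Real.one_add_sq_div_two_le_cosh {x : ℝ} (hx : 0 ≤ x) :
    1 + x ^ 2 / 2 ≤ Real.cosh x := by
  have h1 : x / 2 ≤ Real.sinh (x / 2) := Real.self_le_sinh_iff.2 (by positivity)
  have h2 := Real.cosh_two_mul (x / 2)
  have h3 := Real.cosh_sq (x / 2)
  rw [mul_div_cancel₀ x two_ne_zero] at h2
  nlinarith

/-- For `c < 1/2`, the function `x ↦ exp (c * x ^ 2)` does not dominate the hyperbolic cosine. -/
theorem exists_exp_mul_sq_lt_cosh {c : ℝ} (hc : c < 1 / 2) :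
    ∃ x : ℝ, Real.exp (c * x ^ 2) < Real.cosh x := by
  refine ⟨Real.sqrt (1 / 2 - c), ?_⟩
  have hcosh := Real.one_add_sq_div_two_le_cosh (Real.sqrt_nonneg (1 / 2 - c))
  rw [Real.sq_sqrt (by linarith)] at hcosh ⊢
  refine lt_of_lt_of_le ?_ hcosh
  have h1 := Real.one_sub_le_exp_neg (c * (1 / 2 - c))
  have h2 : Real.exp (c * (1 / 2 - c)) * Real.exp (-(c * (1 / 2 - c))) = 1 := by
    rw [← Real.exp_add, add_neg_cancel, Real.exp_zero]
  have hprod : 1 < (1 + (1 / 2 - c) / 2) * (1 - c * (1 / 2 - c)) := by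
    have : 0 < (1 / 2 - c) * ((1 / 2 - c) * (1 - c / 2)) :=
      mul_pos (by linarith) (mul_pos (by linarith) (by linarith))
    linarith
  have h3 : (1 + (1 / 2 - c) / 2) * (1 - c * (1 / 2 - c)) ≤
      (1 + (1 / 2 - c) / 2) * Real.exp (-(c * (1 / 2 - c))) :=
    mul_le_mul_of_nonneg_left h1 (by linarith)
  refine lt_of_mul_lt_mul_right ?_ (Real.exp_pos (-(c * (1 / 2 - c)))).le
  linarith

/-- The moment generating function of the centered indicator at twice the log-odds. -/
theorem centered_indicator_mgf_two_mul_log_odds {p : ℝ} (hp : p ∈ Set.Ioo (0 : ℝ) 1) :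
    p * Real.exp (2 * Real.log ((1 - p) / p) * (1 - p)) +
      (1 - p) * Real.exp (-(2 * Real.log ((1 - p) / p) * p)) =
      Real.exp ((1 - 2 * p) * Real.log ((1 - p) / p)) := by
  obtain ⟨h0, h1⟩ := hp
  have hexp : Real.exp (Real.log ((1 - p) / p)) = (1 - p) / p :=
    Real.exp_log (div_pos (by linarith) h0)
  set L := Real.log ((1 - p) / p)
  have e1 : 2 * L * (1 - p) = L + L + -(2 * L * p) := by ring
  have e2 : (1 - 2 * p) * L = L + -(2 * L * p) := by ring
  rw [e1, e2, Real.exp_add (L + L), Real.exp_add L L, Real.exp_add L, hexp]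
  field_simp
  ring

/-- Minimality part of Theorem 2.1: no subgaussian parameter `τ < Q(p)` works for the
centered indicator with parameter `p`. -/
theorem no_smaller_subgaussian_parameter (p : ℝ) (hp : p ∈ Set.Ioo (0:ℝ) 1)
    (τ : ℝ) (hτ : 0 ≤ τ) (hlt : τ < Q p) :
    ∃ l : ℝ, p * Real.exp (l * (1 - p)) + (1 - p) * Real.exp (-(l * p)) >
      Real.exp (τ^2 * l^2) := by
  have hsq : τ ^ 2 < Qsq p := (Real.lt_sqrt hτ).1 hlt
  unfold Qsq at hsq
  split_ifs at hsq with h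
  · obtain ⟨x, hx⟩ := exists_exp_mul_sq_lt_cosh (c := 4 * τ ^ 2) (by linarith)
    refine ⟨2 * x, ?_⟩
    rw [Real.cosh_eq] at hx
    subst h
    have e1 : 2 * x * (1 - 1 / 2) = x := by ring
    have e2 : 2 * x * (1 / 2) = x := by ring
    have e3 : τ ^ 2 * (2 * x) ^ 2 = 4 * τ ^ 2 * x ^ 2 := by ring
    rw [e1, e2, e3]
    linarith
  · refine ⟨2 * Real.log ((1 - p) / p), ?_⟩
    rw [centered_indicator_mgf_two_mul_log_odds hp, gt_iff_lt, Real.exp_lt_exp]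
    have hL : Real.log ((1 - p) / p) ≠ 0 := by
      refine Real.log_ne_zero_of_pos_of_ne_one (div_pos (by linarith [hp.2]) hp.1) fun h1 => h ?_
      rw [div_eq_one_iff_eq hp.1.ne'] at h1
      linarith
    calc τ ^ 2 * (2 * Real.log ((1 - p) / p)) ^ 2
        < (1 - 2 * p) / (4 * Real.log ((1 - p) / p)) * (2 * Real.log ((1 - p) / p)) ^ 2 :=
          mul_lt_mul_of_pos_right hsq (by positivity)
      _ = (1 - 2 * p) * Real.log ((1 - p) / p) := by
          field_simp
          ring
end

section
/- Let p ∈ (0,1), p ≠ 1/2, and define g_p(λ) = ln(p·e^{(1−p)λ} + (1−p)·e^{−pλ})/λ² for λ ≠ 0. Then the derivative of g_p vanishes at λ₀ = 2·ln((1−p)/p): g_p′(λ₀) = 0. (Remark 2.1: λ₀ is a critical point of the normalized log-mgf.) -/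
/-- Remark 2.1: `λ₀ = 2 ln((1-p)/p)` is a critical point of the normalized log-mgf
`g_p(λ) = ln(p e^{(1-p)λ} + (1-p) e^{-pλ}) / λ²` of the centered indicator. -/
theorem deriv_g_vanishes_at_lambda_zero (p : ℝ) (hp : p ∈ Set.Ioo (0:ℝ) 1)
    (hp2 : p ≠ 1/2) :
    HasDerivAt
      (fun l : ℝ =>
        Real.log (p * Real.exp ((1 - p) * l) + (1 - p) * Real.exp (-(p * l))) / l^2)
      0 (2 * Real.log ((1 - p) / p)) := by
  obtain ⟨hp0, hp1⟩ := hp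
  have hq : 0 < 1 - p := sub_pos.2 hp1
  have hr : 0 < (1 - p) / p := div_pos hq hp0
  have hr1 : (1 - p) / p ≠ 1 := by
    intro h
    rw [div_eq_one_iff_eq hp0.ne'] at h
    exact hp2 (by linarith)
  set L := Real.log ((1 - p) / p) with hL
  have hL0 : L ≠ 0 := Real.log_ne_zero_of_pos_of_ne_one hr hr1
  have hexpL : Real.exp L = (1 - p) / p := Real.exp_log hr
  set E := Real.exp (-(p * (2 * L))) with hE
  have hE0 : 0 < E := Real.exp_pos _
  have hexp : Real.exp ((1 - p) * (2 * L)) = ((1 - p) / p) ^ 2 * E := by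
    rw [← hexpL, ← Real.exp_nat_mul, hE, ← Real.exp_add]
    congr 1
    push_cast
    ring
  have hM : p * Real.exp ((1 - p) * (2 * L)) + (1 - p) * E = (1 - p) / p * E := by
    rw [hexp]
    field_simp
    ring
  have hlog : Real.log ((1 - p) / p * E) = (1 - 2 * p) * L := by
    rw [Real.log_mul hr.ne' hE0.ne', hE, Real.log_exp, ← hL]
    ring
  have hderiv : HasDerivAt
      (fun l : ℝ => p * Real.exp ((1 - p) * l) + (1 - p) * Real.exp (-(p * l)))
      (p * (Real.exp ((1 - p) * (2 * L)) * ((1 - p) * 1)) + (1 - p) * (E * -(p * 1)))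
      (2 * L) :=
    ((((hasDerivAt_id' (2 * L)).const_mul (1 - p)).exp).const_mul p).add
      ((((hasDerivAt_id' (2 * L)).const_mul p).neg.exp).const_mul (1 - p))
  have hM0 : p * Real.exp ((1 - p) * (2 * L)) + (1 - p) * E ≠ 0 := by
    rw [hM]
    positivity
  have h := (hderiv.log hM0).div (hasDerivAt_pow 2 (2 * L))
    (pow_ne_zero 2 (mul_ne_zero two_ne_zero hL0))
  refine h.congr_deriv ?_
  rw [← hE, hM, hlog, hexp]
  have hlogDeriv : (p * (((1 - p) / p) ^ 2 * E * ((1 - p) * 1)) + (1 - p) * (E * -(p * 1))) /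
      ((1 - p) / p * E) = 1 - 2 * p := by
    field_simp
    ring
  rw [hlogDeriv]
  norm_num
  left
  ring
end

section
/- Let m be a positive integer, let c(1), …, c(m) be real numbers, let p(1), …, p(m) ∈ (0,1), and let A(1), …, A(m) be events (not necessarily disjoint or independent) on a probability space with P(A(j)) = p(j). Set ν = Σ_{j=1}^m c(j)·(1_{A(j)} − p(j)). Then for every real λ, E exp(λν) ≤ exp(λ²·(Σ_{j=1}^m |c(j)|·Q(p(j)))²), where Q(p)² = (1−2p)/(4·ln((1−p)/p)) for p ≠ 1/2 and Q(1/2)² = 1/8. (Consequence 2.1 with finite m.) -/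
open MeasureTheory

theorem hasDerivAt_sinh_div_mul_cosh {u : ℝ} (hu : 0 < u) :
    HasDerivAt (fun x : ℝ => Real.sinh x / (x * Real.cosh x))
      ((u - Real.sinh u * Real.cosh u) / (u * Real.cosh u) ^ 2) u := by
  have hc := Real.cosh_pos u
  have h := (Real.hasDerivAt_sinh u).div ((hasDerivAt_id u).mul (Real.hasDerivAt_cosh u))
    (mul_pos hu hc).ne'
  refine h.congr_deriv ?_
  simp only [Pi.mul_apply, id]
  congr 1
  linear_combination u * Real.cosh_sq_sub_sinh_sq u

theorem antitoneOn_sinh_div_mul_cosh :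
    AntitoneOn (fun x : ℝ => Real.sinh x / (x * Real.cosh x)) (Set.Ioi 0) := by
  refine antitoneOn_of_deriv_nonpos (convex_Ioi 0)
    (fun x hx => (hasDerivAt_sinh_div_mul_cosh hx).continuousAt.continuousWithinAt) ?_ ?_
  · rw [interior_Ioi]
    exact fun x hx => (hasDerivAt_sinh_div_mul_cosh hx).differentiableAt.differentiableWithinAt
  · rw [interior_Ioi]
    intro x hx
    rw [(hasDerivAt_sinh_div_mul_cosh hx).deriv]
    have h1 : x ≤ Real.sinh x := Real.self_le_sinh_iff.2 (le_of_lt hx)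
    have h2 := Real.one_le_cosh x
    have h3 : (0 : ℝ) < x := hx
    exact div_nonpos_of_nonpos_of_nonneg (by nlinarith) (sq_nonneg _)

theorem hasDerivAt_mul_sq_sub_log_cosh (k u : ℝ) :
    HasDerivAt (fun x : ℝ => k * x ^ 2 - Real.log (Real.cosh x))
      (2 * k * u - Real.sinh u / Real.cosh u) u := by
  have h := (((hasDerivAt_id u).pow 2).const_mul k).sub
    ((Real.hasDerivAt_cosh u).log (Real.cosh_pos u).ne')
  refine h.congr_deriv ?_
  simp
  ring

/-- The tangent-line bound for the concave function `x ↦ log (cosh (√x))`, at `x = b²`. -/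
theorem log_cosh_le_of_pos {b u : ℝ} (hb : 0 < b) (hu : 0 ≤ u) :
    Real.log (Real.cosh u) ≤ Real.log (Real.cosh b) +
      Real.sinh b / (2 * (b * Real.cosh b)) * (u ^ 2 - b ^ 2) := by
  set k := Real.sinh b / (2 * (b * Real.cosh b)) with hk
  have hk2 : 2 * k = Real.sinh b / (b * Real.cosh b) := by
    have := (Real.cosh_pos b).ne'
    rw [hk]; field_simp
  have hder : ∀ x : ℝ, 0 < x → 2 * k * x - Real.sinh x / Real.cosh x =
      x * (Real.sinh b / (b * Real.cosh b) - Real.sinh x / (x * Real.cosh x)) := by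
    intro x hx
    have := (Real.cosh_pos x).ne'
    rw [hk2, mul_sub]
    congr 1
    · ring
    · field_simp
  have hcont : Continuous fun x : ℝ => k * x ^ 2 - Real.log (Real.cosh x) :=
    continuous_iff_continuousAt.2 fun x => (hasDerivAt_mul_sq_sub_log_cosh k x).continuousAt
  have hdiff : Differentiable ℝ fun x : ℝ => k * x ^ 2 - Real.log (Real.cosh x) :=
    fun x => (hasDerivAt_mul_sq_sub_log_cosh k x).differentiableAt
  suffices h : k * b ^ 2 - Real.log (Real.cosh b) ≤ k * u ^ 2 - Real.log (Real.cosh u) by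
    linarith
  rcases le_total u b with hub | hbu
  · have hanti : AntitoneOn (fun x : ℝ => k * x ^ 2 - Real.log (Real.cosh x)) (Set.Icc 0 b) := by
      refine antitoneOn_of_deriv_nonpos (convex_Icc 0 b) hcont.continuousOn
        hdiff.differentiableOn ?_
      rw [interior_Icc]
      intro x hx
      rw [(hasDerivAt_mul_sq_sub_log_cosh k x).deriv, hder x hx.1]
      have := antitoneOn_sinh_div_mul_cosh hx.1 hb hx.2.le
      exact mul_nonpos_of_nonneg_of_nonpos hx.1.le (sub_nonpos.2 this)
    exact hanti ⟨hu, hub⟩ ⟨hb.le, le_rfl⟩ hub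
  · have hmono : MonotoneOn (fun x : ℝ => k * x ^ 2 - Real.log (Real.cosh x)) (Set.Ici b) := by
      refine monotoneOn_of_deriv_nonneg (convex_Ici b) hcont.continuousOn
        hdiff.differentiableOn ?_
      rw [interior_Ici]
      intro x hx
      have hx0 : 0 < x := hb.trans hx
      rw [(hasDerivAt_mul_sq_sub_log_cosh k x).deriv, hder x hx0]
      have := antitoneOn_sinh_div_mul_cosh hb hx0 (le_of_lt hx)
      exact mul_nonneg hx0.le (sub_nonneg.2 this)
    exact hmono (Set.self_mem_Ici) hbu hbu

theorem log_cosh_le {b : ℝ} (hb : b ≠ 0) (u : ℝ) :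
    Real.log (Real.cosh u) ≤ Real.log (Real.cosh b) +
      Real.sinh b / (2 * (b * Real.cosh b)) * (u ^ 2 - b ^ 2) := by
  rcases hb.lt_or_gt with h | h
  · have := log_cosh_le_of_pos (neg_pos.2 h) (abs_nonneg u)
    simpa only [Real.cosh_abs, Real.cosh_neg, Real.sinh_neg, sq_abs, neg_sq, neg_mul, mul_neg,
      neg_div_neg_eq] using this
  · simpa only [Real.cosh_abs, sq_abs] using log_cosh_le_of_pos h (abs_nonneg u)

theorem cosh_le_cosh_mul_exp_s6 {b : ℝ} (hb : b ≠ 0) (u : ℝ) :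
    Real.cosh u ≤ Real.cosh b *
      Real.exp (Real.sinh b / (2 * (b * Real.cosh b)) * (u ^ 2 - b ^ 2)) := by
  have h := Real.exp_le_exp.2 (log_cosh_le hb u)
  rwa [Real.exp_add, Real.exp_log (Real.cosh_pos u), Real.exp_log (Real.cosh_pos b)] at h

theorem one_sub_two_mul_eq_sinh_div_cosh {p b : ℝ} (hpb : p * (2 * Real.cosh b) = Real.exp (-b)) :
    1 - 2 * p = Real.sinh b / Real.cosh b := by
  rw [eq_div_iff (Real.cosh_pos b).ne', Real.sinh_eq]
  rw [Real.cosh_eq] at *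
  linarith

theorem mul_two_mul_cosh_half_log {p : ℝ} (hp : p ∈ Set.Ioo (0 : ℝ) 1) :
    p * (2 * Real.cosh (Real.log ((1 - p) / p) / 2)) =
      Real.exp (-(Real.log ((1 - p) / p) / 2)) := by
  obtain ⟨h0, h1⟩ := hp
  set b := Real.log ((1 - p) / p) / 2 with hb
  have hpos : 0 < (1 - p) / p := div_pos (by linarith) h0
  have he : Real.exp b * Real.exp b = (1 - p) / p := by
    rw [← Real.exp_add, hb, add_halves, Real.exp_log hpos]
  rw [eq_div_iff h0.ne'] at he
  have hi : Real.exp b * Real.exp (-b) = 1 := by rw [← Real.exp_add]; simp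
  rw [Real.cosh_eq]
  linear_combination Real.exp (-b) * he - p * Real.exp b * hi

theorem log_one_sub_div_ne_zero {p : ℝ} (hp : p ∈ Set.Ioo (0 : ℝ) 1) (h : p ≠ 1 / 2) :
    Real.log ((1 - p) / p) ≠ 0 := by
  obtain ⟨h0, h1⟩ := hp
  refine Real.log_ne_zero_of_pos_of_ne_one (div_pos (by linarith) h0) fun h' => h ?_
  rw [div_eq_one_iff_eq h0.ne'] at h'
  linarith

theorem Qsq_pos {p : ℝ} (hp : p ∈ Set.Ioo (0 : ℝ) 1) : 0 < Qsq p := by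
  unfold Qsq
  split_ifs with h
  · norm_num
  · obtain ⟨h0, h1⟩ := hp
    rcases lt_or_gt_of_ne h with h | h
    · refine div_pos (by linarith) (mul_pos (by norm_num) (Real.log_pos ?_))
      rw [one_lt_div h0]; linarith
    · refine div_pos_of_neg_of_neg (by linarith) (mul_neg_of_pos_of_neg (by norm_num)
        (Real.log_neg (div_pos (by linarith) h0) ?_))
      rw [div_lt_one h0]; linarith

/-- The Kearns–Saul inequality: the moment generating function of a centered indicator. -/
theorem mgf_centered_indicator_le {p : ℝ} (hp : p ∈ Set.Ioo (0 : ℝ) 1) (t : ℝ) :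
    p * Real.exp (t * (1 - p)) + (1 - p) * Real.exp (-(t * p)) ≤ Real.exp (t ^ 2 * Qsq p) := by
  by_cases h : p = 1 / 2
  · have := Real.cosh_le_exp_half_sq (t / 2)
    rw [Real.cosh_eq] at this
    subst h
    rw [Qsq, if_pos rfl]
    convert this using 1 <;> ring_nf
  · have hlog := log_one_sub_div_ne_zero hp h
    have hpb := mul_two_mul_cosh_half_log hp
    set b := Real.log ((1 - p) / p) / 2 with hb
    have hb0 : b ≠ 0 := div_ne_zero hlog two_ne_zero
    have hc := (Real.cosh_pos b).ne'
    have hq := one_sub_two_mul_eq_sinh_div_cosh hpb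
    have hqb : (1 - p) * (2 * Real.cosh b) = Real.exp b := by
      have := Real.cosh_eq b
      linarith
    have hlhs : (p * Real.exp (t * (1 - p)) + (1 - p) * Real.exp (-(t * p))) * Real.cosh b =
        Real.exp (t * (1 / 2 - p)) * Real.cosh (t / 2 - b) := by
      have e1 : Real.exp (-b) * Real.exp (t * (1 - p)) =
          Real.exp (t * (1 / 2 - p)) * Real.exp (t / 2 - b) := by
        rw [← Real.exp_add, ← Real.exp_add]; ring_nf
      have e2 : Real.exp b * Real.exp (-(t * p)) =
          Real.exp (t * (1 / 2 - p)) * Real.exp (-(t / 2 - b)) := by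
        rw [← Real.exp_add, ← Real.exp_add]; ring_nf
      rw [Real.cosh_eq (t / 2 - b)]
      linear_combination Real.exp (t * (1 - p)) / 2 * hpb + Real.exp (-(t * p)) / 2 * hqb +
        e1 / 2 + e2 / 2
    have hQ : Qsq p = Real.sinh b / (8 * (b * Real.cosh b)) := by
      have hl : Real.log ((1 - p) / p) = 2 * b := by rw [hb]; ring
      rw [Qsq, if_neg h, hq, hl]
      field_simp
      norm_num
    have hexp : t * (1 / 2 - p) +
        Real.sinh b / (2 * (b * Real.cosh b)) * ((t / 2 - b) ^ 2 - b ^ 2) = t ^ 2 * Qsq p := by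
      have : (1 / 2 - p) = Real.sinh b / Real.cosh b / 2 := by linarith
      rw [hQ, this]
      field_simp
      ring
    refine le_of_mul_le_mul_right ?_ (Real.cosh_pos b)
    rw [hlhs, ← hexp, Real.exp_add]
    calc _ ≤ Real.exp (t * (1 / 2 - p)) * _ :=
          mul_le_mul_of_nonneg_left (cosh_le_cosh_mul_exp_s6 hb0 _) (Real.exp_pos _).le
      _ = _ := by ring

theorem exp_mul_indicator_sub {Ω : Type*} (A : Set Ω) (p t : ℝ) :
    (fun ω => Real.exp (t * (Set.indicator A (fun _ => (1 : ℝ)) ω - p))) =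
      fun ω => Set.indicator A (fun _ => Real.exp (t * (1 - p)) - Real.exp (-(t * p))) ω +
        Real.exp (-(t * p)) := by
  funext ω
  by_cases h : ω ∈ A <;> simp [h]

theorem integrable_exp_mul_indicator_sub {Ω : Type*} [MeasurableSpace Ω] (μ : Measure Ω)
    [IsProbabilityMeasure μ] {A : Set Ω} (hA : MeasurableSet A) (p t : ℝ) :
    Integrable (fun ω => Real.exp (t * (Set.indicator A (fun _ => (1 : ℝ)) ω - p))) μ := by
  rw [exp_mul_indicator_sub]
  exact ((integrable_const _).indicator hA).add (integrable_const _)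

theorem integral_exp_mul_indicator_sub_le {Ω : Type*} [MeasurableSpace Ω] (μ : Measure Ω)
    [IsProbabilityMeasure μ] {A : Set Ω} (hA : MeasurableSet A) {p : ℝ}
    (hp : p ∈ Set.Ioo (0 : ℝ) 1) (hPA : μ A = ENNReal.ofReal p) (t : ℝ) :
    ∫ ω, Real.exp (t * (Set.indicator A (fun _ => (1 : ℝ)) ω - p)) ∂μ ≤
      Real.exp (t ^ 2 * Qsq p) := by
  refine le_trans (le_of_eq ?_) (mgf_centered_indicator_le hp t)
  have hreal : μ.real A = p := by rw [measureReal_def, hPA, ENNReal.toReal_ofReal hp.1.le]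
  rw [exp_mul_indicator_sub, integral_add ((integrable_const _).indicator hA) (integrable_const _),
    integral_indicator_const _ hA, hreal]
  simp
  ring

/-- Consequence 2.1 (finite `m`): a linear combination
`ν = Σ c(j) (1_{A(j)} - p(j))` of centered indicators is subgaussian with parameter
`Σ |c(j)| Q(p(j))`; the events need not be disjoint or independent. -/
theorem linear_combination_centered_indicators_subgaussian
    {Ω : Type*} [MeasurableSpace Ω] (μ : Measure Ω) [IsProbabilityMeasure μ]
    (m : ℕ) (hm : 0 < m) (c : Fin m → ℝ) (p : Fin m → ℝ)
    (hp : ∀ j, p j ∈ Set.Ioo (0:ℝ) 1)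
    (A : Fin m → Set Ω) (hA : ∀ j, MeasurableSet (A j))
    (hPA : ∀ j, μ (A j) = ENNReal.ofReal (p j)) (l : ℝ) :
    ∫ ω, Real.exp (l * ∑ j, c j * (Set.indicator (A j) (fun _ => (1:ℝ)) ω - p j)) ∂μ ≤
      Real.exp (l^2 * (∑ j, |c j| * Q (p j))^2) := by
  have hQ : ∀ j, 0 < Q (p j) := fun j => Real.sqrt_pos.2 (Qsq_pos (hp j))
  have hterm : ∀ j ∈ Finset.univ, 0 ≤ |c j| * Q (p j) :=
    fun j _ => mul_nonneg (abs_nonneg _) (hQ j).le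
  set S := ∑ j, |c j| * Q (p j) with hS
  rcases (Finset.sum_nonneg hterm).eq_or_lt with hS0 | hSpos
  · have hc : ∀ j, c j = 0 := fun j => by
      have := (Finset.sum_eq_zero_iff_of_nonneg hterm).1 hS0.symm j (Finset.mem_univ j)
      simpa [(hQ j).ne'] using this
    simp [hc, hS]
  set w : Fin m → ℝ := fun j => |c j| * Q (p j) / S with hw
  set t : Fin m → ℝ := fun j => l * S * SignType.sign (c j) / Q (p j) with ht
  have hw0 : ∀ j, 0 ≤ w j := fun j => div_nonneg (hterm j (Finset.mem_univ j)) hSpos.le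
  have hw1 : ∑ j, w j = 1 := by
    rw [hw, ← Finset.sum_div, ← hS, div_self hSpos.ne']
  have hwt : ∀ j, w j * t j = l * c j := fun j => by
    have h1 := (hQ j).ne'
    have h2 : S ≠ 0 := hSpos.ne'
    have h3 := abs_mul_sign (c j)
    simp only [hw, ht]
    field_simp
    linear_combination l * h3
  have hts : ∀ j, t j ^ 2 * Qsq (p j) ≤ l ^ 2 * S ^ 2 := fun j => by
    have h1 : Q (p j) ^ 2 = Qsq (p j) := Real.sq_sqrt (Qsq_pos (hp j)).le
    have h2 := (hQ j).ne'
    have h3 : (SignType.sign (c j) : ℝ) ^ 2 ≤ 1 := by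
      rcases SignType.sign (c j) with _ | _ | _ <;> simp
    have h4 : t j ^ 2 * Qsq (p j) = (l ^ 2 * S ^ 2) * (SignType.sign (c j) : ℝ) ^ 2 := by
      rw [← h1]
      simp only [ht]
      field_simp
    rw [h4]
    exact mul_le_of_le_one_right (by positivity) h3
  have hint := fun j => (integrable_exp_mul_indicator_sub μ (hA j) (p j) (t j)).const_mul (w j)
  calc _ ≤ ∫ ω, ∑ j, w j *
        Real.exp (t j * (Set.indicator (A j) (fun _ => (1 : ℝ)) ω - p j)) ∂μ := by
        refine integral_mono_of_nonneg (.of_forall fun ω => (Real.exp_pos _).le)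
          (integrable_finsetSum _ fun j _ => hint j) (.of_forall fun ω => ?_)
        have h := convexOn_exp.map_sum_le (t := Finset.univ) (w := w)
          (p := fun j => t j * (Set.indicator (A j) (fun _ => (1 : ℝ)) ω - p j))
          (fun j _ => hw0 j) hw1 (fun _ _ => Set.mem_univ _)
        simp only [smul_eq_mul, ← mul_assoc, hwt] at h
        simpa only [Finset.mul_sum, ← mul_assoc] using h
    _ = ∑ j, w j * ∫ ω, Real.exp (t j * (Set.indicator (A j) (fun _ => (1 : ℝ)) ω - p j)) ∂μ := by
        rw [integral_finsetSum _ fun j _ => hint j]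
        simp only [integral_const_mul]
    _ ≤ ∑ j, w j * Real.exp (l ^ 2 * S ^ 2) := by
        refine Finset.sum_le_sum fun j _ => mul_le_mul_of_nonneg_left ?_ (hw0 j)
        exact (integral_exp_mul_indicator_sub_le μ (hA j) (hp j) (hPA j) (t j)).trans
          (Real.exp_le_exp.2 (hts j))
    _ = _ := by rw [← Finset.sum_mul, hw1, one_mul]
end
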